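/- Let α ∈ (0,1) be irrational, T the rotation of angle α viewed as a 2-interval exchange transformation on [0,1) with discontinuity 1 − α, N ≥ 2 an integer, and T_f the Veech 1969 type extension of T with single marked point ζ₁ and integers a₁, a₂. If ζ₁ = m − mα for an integer m ≥ 1 with 0 < m − mα < 1, then T_f is minimal if and only if gcd(N, m·a₁, a₂) = 1. -/

import Mathlib

open Set

noncomputable section

/-- The rotation of angle `α` on `[0,1)`: `x ↦ x + α mod 1`. -/
def rot (α : ℝ) (x : ℝ) : ℝ := Int.fract (x + α)

/-- The skew product `T_f(x,s) = (Tx, s + f(x))` on `[0,1) × ℤ/Nℤ`. -/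
def skew {N : ℕ} (T : ℝ → ℝ) (f : ℝ → ZMod N) : ℝ × ZMod N → ℝ × ZMod N :=
  fun p => (T p.1, p.2 + f p.1)

/-- Minimality of the skew product on `[0,1) × ℤ/Nℤ`, where `[0,1)` carries the topology of
the circle `ℝ/ℤ` (distances being measured in `AddCircle 1`) and `ℤ/Nℤ` is discrete:
every forward orbit is dense. -/
def MinimalExt {N : ℕ} (T : ℝ → ℝ) (f : ℝ → ZMod N) : Prop :=
  ∀ x ∈ Ico (0:ℝ) 1, ∀ s : ZMod N, ∀ y ∈ Ico (0:ℝ) 1, ∀ u : ZMod N, ∀ ε > 0, ∃ n : ℕ,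
    dist (((skew T f)^[n] (x, s)).1 : AddCircle (1:ℝ)) (y : AddCircle (1:ℝ)) < ε ∧
    ((skew T f)^[n] (x, s)).2 = u


/-- The two-valued step function: `a₁` on `[0,ζ)` and `a₂` on `[ζ,1)` (values in `ℤ/Nℤ`). -/
def twoval (N : ℕ) (ζ : ℝ) (a₁ a₂ : ℤ) (x : ℝ) : ZMod N :=
  if x < ζ then (a₁ : ZMod N) else (a₂ : ZMod N)

/-- The natural multiples of an irrational number are dense modulo `1`. -/
lemma Irrational.exists_nat_mul_sub_int_mem_Ioo {α : ℝ} (hirr : Irrational α) {A B : ℝ}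
    (hAB : A < B) : ∃ (n : ℕ) (k : ℤ), (n : ℝ) * α - k ∈ Ioo A B := by
  have hd : DenseRange ((· • (α : AddCircle (1 : ℝ))) : ℕ → AddCircle (1 : ℝ)) :=
    denseRange_zsmul_iff_nsmul.1
      ((AddCircle.denseRange_zsmul_coe_iff).2 (by simpa using hirr))
  have hopen : IsOpen ((QuotientAddGroup.mk : ℝ → AddCircle (1 : ℝ)) '' Ioo A B) :=
    QuotientAddGroup.isOpenMap_coe _ isOpen_Ioo
  obtain ⟨n, t, ht, hn⟩ := hd.exists_mem_open hopen ((nonempty_Ioo.2 hAB).image _)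
  have h : ((n * α - t : ℝ) : AddCircle (1 : ℝ)) = 0 := by
    have h1 : ((n * α : ℝ) : AddCircle (1 : ℝ)) = n • (α : AddCircle (1 : ℝ)) := by
      rw [← nsmul_eq_mul]; rfl
    rw [AddCircle.coe_sub, h1, sub_eq_zero]
    exact hn.symm
  obtain ⟨k, hk⟩ := (AddCircle.coe_eq_zero_iff (1 : ℝ)).1 h
  refine ⟨n, k, ?_⟩
  rw [zsmul_eq_mul, mul_one] at hk
  rwa [hk, sub_sub_cancel]

/-- The sum of the integer parts of `z`, `z + α`, …, `z + (m - 1)α`. -/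
def floorSum (α : ℝ) (m : ℕ) (z : ℝ) : ℤ := ∑ i ∈ Finset.range m, ⌊z + i * α⌋

lemma floorSum_rot {α : ℝ} (m : ℕ) {z : ℝ} (hz : z ∈ Ico (0 : ℝ) 1) :
    floorSum α m (rot α z) = floorSum α m z + ⌊z + m * α⌋ - m * ⌊z + α⌋ := by
  have h (i : ℕ) : ⌊rot α z + i * α⌋ = ⌊z + (i + 1 : ℕ) * α⌋ - ⌊z + α⌋ := by
    rw [rot, Int.fract, ← Int.floor_sub_intCast]
    congr 1
    push_cast
    ring
  have h0 : ⌊z + (0 : ℕ) * α⌋ = 0 := by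
    simpa using Int.floor_eq_zero_iff.2 hz
  have h1 := Finset.sum_range_succ (fun i : ℕ => ⌊z + i * α⌋) m
  have h2 := Finset.sum_range_succ' (fun i : ℕ => ⌊z + i * α⌋) m
  simp only [floorSum, h, Finset.sum_sub_distrib, Finset.sum_const, Finset.card_range,
    nsmul_eq_mul]
  linarith

lemma eventually_nhdsGE_floorSum_eq (α : ℝ) (m : ℕ) (y : ℝ) :
    ∀ᶠ z in nhdsWithin y (Ici y), floorSum α m z = floorSum α m y := by
  have h : ∀ i ∈ Finset.range m,
      ∀ᶠ z in nhdsWithin y (Ici y), ⌊z + i * α⌋ = ⌊y + i * α⌋ := by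
    intro i _
    have hlt : y < ⌊y + i * α⌋ + 1 - i * α := by
      linarith [Int.lt_floor_add_one (y + i * α)]
    filter_upwards [self_mem_nhdsWithin, mem_nhdsWithin_of_mem_nhds (Iio_mem_nhds hlt)]
      with z hz hz'
    rw [Int.floor_eq_iff]
    simp only [mem_Ici, mem_Iio] at hz hz'
    constructor <;> linarith [Int.floor_le (y + i * α)]
  filter_upwards [(Filter.eventually_all_finset _).2 h] with z hz
  exact Finset.sum_congr rfl hz

lemma exists_floorSum_eq_on_Ico (α : ℝ) (m : ℕ) (y : ℝ) :
    ∃ c > y, ∀ z ∈ Ico y c, floorSum α m z = floorSum α m y := by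
  obtain ⟨c, hc, h⟩ :=
    (mem_nhdsGE_iff_exists_Ico_subset).1 (eventually_nhdsGE_floorSum_eq α m y)
  exact ⟨c, hc, fun z hz => h hz⟩

lemma twoval_eq {α ζ : ℝ} (N m : ℕ) (a₁ a₂ : ℤ) (hζ : ζ = (m : ℝ) - m * α)
    (hζmem : ζ ∈ Ioo (0 : ℝ) 1) {z : ℝ} (hz : z ∈ Ico (0 : ℝ) 1) :
    twoval N ζ a₁ a₂ z = ((a₂ + (a₁ - a₂) * (m - ⌊z + m * α⌋) : ℤ) : ZMod N) := by
  obtain ⟨h0, h1⟩ := hz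
  obtain ⟨h2, h3⟩ := hζmem
  by_cases h : z < ζ
  · have : ⌊z + m * α⌋ = (m : ℤ) - 1 := by
      rw [Int.floor_eq_iff]; push_cast; constructor <;> linarith
    rw [twoval, if_pos h, this]
    congr 1
    ring
  · have : ⌊z + m * α⌋ = (m : ℤ) := by
      rw [Int.floor_eq_iff]; push_cast; constructor <;> linarith
    rw [twoval, if_neg h, this]
    congr 1
    ring

/-- Explicit form of the iterates: the cocycle is cohomologous, through `floorSum`, to one taking
the value `a₂ + (a₁ - a₂) m` on `[0, 1 - α)` and `a₂` on `[1 - α, 1)`. -/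
lemma skew_iterate {α ζ : ℝ} (N m : ℕ) (a₁ a₂ : ℤ) (hζ : ζ = (m : ℝ) - m * α)
    (hζmem : ζ ∈ Ioo (0 : ℝ) 1) {x : ℝ} (hx : x ∈ Ico (0 : ℝ) 1) (s : ZMod N) (n : ℕ) :
    (skew (rot α) (twoval N ζ a₁ a₂))^[n] (x, s) =
      (Int.fract (x + n * α), s + ((n * a₂ + (a₁ - a₂) * (m * (n - ⌊x + n * α⌋)
        - floorSum α m (Int.fract (x + n * α)) + floorSum α m x) : ℤ) : ZMod N)) := by
  induction n with
  | zero =>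
    simp [Int.fract_eq_self.2 hx, Int.floor_eq_zero_iff.2 hx]
  | succ n ih =>
    have hz : Int.fract (x + n * α) ∈ Ico (0 : ℝ) 1 := ⟨Int.fract_nonneg _, Int.fract_lt_one _⟩
    have hadd : Int.fract (x + n * α) + α = x + (n + 1 : ℕ) * α - ⌊x + n * α⌋ := by
      rw [Int.fract]; push_cast; ring
    have hrot : rot α (Int.fract (x + n * α)) = Int.fract (x + (n + 1 : ℕ) * α) := by
      rw [rot, hadd, Int.fract_sub_intCast]
    have hfloor : ⌊Int.fract (x + n * α) + α⌋ = ⌊x + (n + 1 : ℕ) * α⌋ - ⌊x + n * α⌋ := by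
      rw [hadd, Int.floor_sub_intCast]
    have hsum := floorSum_rot (α := α) m hz
    rw [hrot, hfloor] at hsum
    rw [Function.iterate_succ_apply', ih, skew]
    refine Prod.ext hrot ?_
    simp only
    rw [twoval_eq N m a₁ a₂ hζ hζmem hz, add_assoc, ← Int.cast_add, hsum]
    congr 2
    push_cast
    ring

lemma AddCircle.dist_coe_le (a b : ℝ) : dist (a : AddCircle (1 : ℝ)) b ≤ |a - b| := by
  rw [dist_eq_norm, ← AddCircle.coe_sub, UnitAddCircle.norm_eq]
  simpa using round_le (a - b) 0

/-- A point of `[0, 1)` which is `r`-close to `r` on the circle lies in `(0, 2r)`. -/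
lemma AddCircle.lt_of_dist_coe_lt {a r : ℝ} (ha : a ∈ Ico (0 : ℝ) 1) (hr : 2 * r ≤ 1)
    (h : dist (a : AddCircle (1 : ℝ)) r < r) : a < 2 * r := by
  rw [dist_eq_norm, ← AddCircle.coe_sub, UnitAddCircle.norm_eq, abs_lt] at h
  obtain ⟨ha0, ha1⟩ := ha
  have h1 : round (a - r) < 1 := by
    have : (round (a - r) : ℝ) < 1 := by linarith
    exact_mod_cast this
  have h2 : -1 < round (a - r) := by
    have : (-1 : ℝ) < round (a - r) := by linarith
    exact_mod_cast this
  have h3 : round (a - r) = 0 := by omega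
  rw [h3] at h
  push_cast at h
  linarith

/-- The rotation visits any interval of `[0, 1)` at a time `n` for which the number `⌊x + nα⌋` of
turns and the number `n - ⌊x + nα⌋` of visits to `[0, 1 - α)` are prescribed modulo `N`. -/
lemma exists_fract_mem_Ioo_of_modEq {α : ℝ} (hirr : Irrational α) (N : ℕ) [NeZero N]
    (x : ℝ) {y c : ℝ} (hy : 0 ≤ y) (hc : c ≤ 1) (hyc : y < c) (P Q : ZMod N) :
    ∃ n : ℕ, Int.fract (x + n * α) ∈ Ioo y c ∧
      ((n - ⌊x + n * α⌋ : ℤ) : ZMod N) = P ∧ ((⌊x + n * α⌋ : ℤ) : ZMod N) = Q := by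
  have hN : (0 : ℝ) < N := by exact_mod_cast Nat.pos_of_ne_zero (NeZero.ne N)
  set d : ℝ := x + (P.val + Q.val) * α - Q.val with hd
  obtain ⟨j, k, h1, h2⟩ := hirr.exists_nat_mul_sub_int_mem_Ioo
    (div_lt_div_of_pos_right (sub_lt_sub_right hyc d) hN)
  rw [div_lt_iff₀ hN] at h1
  rw [lt_div_iff₀ hN] at h2
  set n : ℕ := P.val + Q.val + N * j with hn
  have hval : x + n * α - (Q.val + N * k : ℤ) = (j * α - k) * N + d := by
    rw [hn, hd]; push_cast; ring
  have hfl : ⌊x + n * α⌋ = Q.val + N * k := by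
    rw [Int.floor_eq_iff]
    constructor <;> linarith
  refine ⟨n, ?_, ?_, ?_⟩
  · rw [Int.fract, hfl, hval]
    constructor <;> linarith
  · rw [hfl, hn]; simp
  · rw [hfl]; simp

lemma exists_eq_zmod_of_forall_dvd (N : ℕ) (b c : ℤ)
    (h : ∀ k : ℤ, k ∣ (N : ℤ) → k ∣ b → k ∣ c → IsUnit k) (w : ZMod N) :
    ∃ p q : ZMod N, p * b + q * c = w := by
  have hco : IsCoprime (N : ℤ) (gcd b c) := by
    rw [← gcd_isUnit_iff]
    exact h _ (gcd_dvd_left _ _) ((gcd_dvd_right _ _).trans (gcd_dvd_left _ _))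
      ((gcd_dvd_right _ _).trans (gcd_dvd_right _ _))
  obtain ⟨r, t, hrt⟩ := hco
  obtain ⟨p, q, hpq⟩ := exists_gcd_eq_mul_add_mul b c
  refine ⟨w * t * p, w * t * q, ?_⟩
  have := congrArg (Int.cast : ℤ → ZMod N) hrt
  rw [hpq] at this
  push_cast at this
  rw [ZMod.natCast_self, mul_zero, zero_add] at this
  linear_combination w * this

/-- If `ζ₁ = m - mα` with `m ≥ 1` and `0 < m - mα < 1`, the extension `T_f` of the rotation by `α` is minimal iff `gcd(N, m·a₁, a₂) = 1`. -/
theorem twoval_minimal_iff_of_eq_sub_mul_alpha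
    (α : ℝ) (hα : α ∈ Ioo (0:ℝ) 1) (hirr : Irrational α) (N : ℕ) (hN : 2 ≤ N)
    (m : ℤ) (hm : 1 ≤ m) (a₁ a₂ : ℤ) (ζ : ℝ) (hζ : ζ = (m : ℝ) - (m : ℝ) * α)
    (hζmem : ζ ∈ Ioo (0:ℝ) 1)  :
    MinimalExt (rot α) (twoval N ζ a₁ a₂) ↔
      ∀ k : ℤ, k ∣ (N : ℤ) → k ∣ m * a₁ → k ∣ a₂ → IsUnit k := by
  obtain ⟨m, rfl⟩ : ∃ m' : ℕ, m = m' := ⟨m.toNat, by omega⟩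
  rw [Int.cast_natCast] at hζ
  have hN0 : NeZero N := ⟨by omega⟩
  constructor
  · intro hmin k hkN hk₁ hk₂
    obtain ⟨c, hc, hconst⟩ := exists_floorSum_eq_on_Ico α m 0
    have hr : 0 < min c 1 / 2 := by positivity
    have hr' : 2 * (min c 1 / 2) ≤ 1 := by linarith [min_le_right c 1]
    have h0 : (0 : ℝ) ∈ Ico (0 : ℝ) 1 := ⟨le_rfl, one_pos⟩
    obtain ⟨n, hn, hn'⟩ := hmin 0 h0 0 (min c 1 / 2) ⟨hr.le, by linarith⟩ 1 _ hr
    rw [skew_iterate N m a₁ a₂ hζ hζmem h0] at hn hn'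
    simp only at hn hn'
    have hmem : Int.fract (0 + n * α) ∈ Ico (0 : ℝ) 1 :=
      ⟨Int.fract_nonneg _, Int.fract_lt_one _⟩
    have hlt := AddCircle.lt_of_dist_coe_lt hmem hr' hn
    rw [hconst _ ⟨hmem.1, by linarith [min_le_left c 1]⟩, zero_add, sub_add_cancel,
      ← Int.cast_one, ZMod.intCast_eq_intCast_iff_dvd_sub] at hn'
    set l := (n : ℤ) - ⌊0 + n * α⌋
    have hdvd : k ∣ n * a₂ + (a₁ - a₂) * (m * l) := by
      have : n * a₂ + (a₁ - a₂) * (m * l) = l * (m * a₁) + (n - m * l) * a₂ := by ring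
      rw [this]
      exact dvd_add (hk₁.mul_left _) (hk₂.mul_left _)
    exact isUnit_of_dvd_one ((dvd_sub_left hdvd).1 (hkN.trans hn'))
  · intro h x hx s y hy u ε hε
    obtain ⟨c, hc, hconst⟩ := exists_floorSum_eq_on_Ico α m y
    obtain ⟨p, q, hpq⟩ := exists_eq_zmod_of_forall_dvd N (m * a₁) a₂ h
      (u - s - ((a₁ - a₂) * (floorSum α m x - floorSum α m y) : ℤ))
    have hyc : y < min c (min 1 (y + ε)) := by
      simp only [lt_min_iff]
      exact ⟨hc, hy.2, by linarith⟩
    obtain ⟨n, ⟨hn₁, hn₂⟩, hP, hQ⟩ := exists_fract_mem_Ioo_of_modEq hirr N x hy.1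
      ((min_le_right _ _).trans (min_le_left _ _)) hyc p (q - (1 - m) * p)
    simp only [lt_min_iff] at hn₂
    refine ⟨n, ?_, ?_⟩ <;> rw [skew_iterate N m a₁ a₂ hζ hζmem hx]
    · refine (AddCircle.dist_coe_le _ _).trans_lt ?_
      rw [abs_lt]
      constructor <;> linarith
    · simp only
      rw [hconst _ ⟨hn₁.le, hn₂.1⟩]
      push_cast at hpq hP hQ ⊢
      linear_combination hpq + (a₂ + (a₁ - a₂) * m) * hP + a₂ * hQ
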